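/- Power sum expansion of the noncommutative Redei–Berge function: for any digraph X = (V, E) and every coloring f : V → ℤ⁺, N(f, X) = Σ (−1)^{φ(σ)}, where the sum is over all permutations σ ∈ 𝕊_V(X, X̄) such that f is constant on each cycle of σ. (Equivalently, W_X = Σ_{σ ∈ 𝕊_V(X, X̄)} (−1)^{φ(σ)} p_{Type(σ)}, where Type(σ) is the set partition of V into the cycles of σ.) -/

import Mathlib

/-- A `V`-listing `σ` (a bijection `Fin n ≃ V`) is `(f, X)`-friendly for the digraph with
edge set `E` and the coloring `f` if the colors are weakly increasing along the listing,
and strictly increase along every edge of the digraph. -/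
def Friendly {V : Type*} [Fintype V] (E : Set (V × V)) (f : V → ℕ+)
    (σ : Fin (Fintype.card V) ≃ V) : Prop :=
  Monotone (fun i => f (σ i)) ∧
  ∀ i : Fin (Fintype.card V), ∀ h : (i : ℕ) + 1 < Fintype.card V,
    (σ i, σ ⟨(i : ℕ) + 1, h⟩) ∈ E → f (σ i) < f (σ ⟨(i : ℕ) + 1, h⟩)

/-- `redeiBergeCount E f` is `N(f, X)`, the number of `(f, X)`-friendly `V`-listings
of the digraph `X = (V, E)`. -/
noncomputable def redeiBergeCount {V : Type*} [Fintype V] (E : Set (V × V)) (f : V → ℕ+) : ℕ :=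
  Nat.card {σ : Fin (Fintype.card V) ≃ V // Friendly E f σ}

/-- A cycle `c` of a permutation (given as one of its cycle factors, with underlying orbit
`c.support`) is a cycle of the digraph with edge set `E` if `(w, c w) ∈ E` for every
vertex `w` of the cycle. -/
def IsDigraphCycle {V : Type*} [Fintype V] [DecidableEq V] (E : Set (V × V))
    (c : Equiv.Perm V) : Prop :=
  ∀ w ∈ c.support, (w, c w) ∈ E

/-- `σ ∈ 𝕊_V(X, X̄)`: every cycle of the permutation `σ` is a cycle of `X` or a cycle of
the complement `X̄`.  (Fixed points of `σ` are automatically cycles of `X` or of `X̄`, so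
only the nontrivial cycle factors need to be checked.) -/
def MemSVXXbar {V : Type*} [Fintype V] [DecidableEq V] (E : Set (V × V))
    (σ : Equiv.Perm V) : Prop :=
  ∀ c ∈ σ.cycleFactorsFinset, IsDigraphCycle E c ∨ IsDigraphCycle Eᶜ c

open Classical in
/-- `φ(σ) = Σ_γ (ℓ(γ) − 1)`, summed over all cycles `γ` of `σ` that are cycles of `X`.
(Fixed points contribute `ℓ − 1 = 0`, so it suffices to sum over nontrivial cycle factors.) -/
noncomputable def phi {V : Type*} [Fintype V] [DecidableEq V] (E : Set (V × V))
    (σ : Equiv.Perm V) : ℕ :=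
  ∑ c ∈ σ.cycleFactorsFinset.filter (fun c => IsDigraphCycle E c), (c.support.card - 1)


section RB
variable {V : Type*}

def RBAdj (L : List V) (x y : V) : Prop := ∃ i : ℕ, L[i]? = some x ∧ L[i+1]? = some y

theorem RBAdj_cons (a : V) (l : List V) (x y : V) :
    RBAdj (a :: l) x y ↔ (a = x ∧ l[0]? = some y) ∨ RBAdj l x y := by
  constructor
  · rintro ⟨i, h1, h2⟩
    rcases i with _ | i
    · left; exact ⟨by simpa using h1, by simpa using h2⟩
    · right; exact ⟨i, by simpa using h1, by simpa using h2⟩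
  · rintro (⟨rfl, h⟩ | ⟨i, h1, h2⟩)
    · exact ⟨0, by simp, by simpa using h⟩
    · exact ⟨i + 1, by simpa using h1, by simpa using h2⟩

theorem RBAdj_mem {L : List V} {x y : V} (h : RBAdj L x y) : x ∈ L ∧ y ∈ L := by
  obtain ⟨i, h1, h2⟩ := h
  exact ⟨List.mem_of_getElem? h1, List.mem_of_getElem? h2⟩

variable [DecidableEq V]

theorem RB_idx {L : List V} (hL : L.Nodup) {i : ℕ} {x : V} (h : L[i]? = some x) :
    L.idxOf x = i := by
  obtain ⟨hi, rfl⟩ := List.getElem?_eq_some_iff.1 h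
  exact hL.idxOf_getElem i hi

theorem RBAdj_iff {L : List V} (hL : L.Nodup) {x y : V} :
    RBAdj L x y ↔ y ∈ L ∧ L.idxOf y = L.idxOf x + 1 := by
  constructor
  · intro h
    refine ⟨(RBAdj_mem h).2, ?_⟩
    obtain ⟨i, h1, h2⟩ := h
    rw [RB_idx hL h1, RB_idx hL h2]
  · rintro ⟨hy, h⟩
    have hlt := List.idxOf_lt_length_iff.2 hy
    refine ⟨L.idxOf x, ?_, ?_⟩
    · rw [List.getElem?_eq_getElem (by omega)]; simp
    · rw [← h, List.getElem?_eq_getElem (by omega)]; simp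

theorem RBAdj_right {L : List V} (hL : L.Nodup) {x y z : V} (h : RBAdj L x y)
    (h' : RBAdj L x z) : y = z := by
  obtain ⟨hy, h1⟩ := (RBAdj_iff hL).1 h
  obtain ⟨hz, h2⟩ := (RBAdj_iff hL).1 h'
  exact (List.idxOf_inj hy).1 (h1.trans h2.symm)

theorem RBAdj_left {L : List V} (hL : L.Nodup) {x y z : V} (h : RBAdj L x y)
    (h' : RBAdj L z y) : x = z := by
  obtain ⟨hy, h1⟩ := (RBAdj_iff hL).1 h
  obtain ⟨hz, h2⟩ := (RBAdj_iff hL).1 h'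
  exact (List.idxOf_inj (RBAdj_mem h).1).1 (by omega)

theorem RBAdj_ne {L : List V} (hL : L.Nodup) {x y : V} (h : RBAdj L x y) : x ≠ y := by
  rintro rfl
  have := ((RBAdj_iff hL).1 h).2
  omega

theorem RBAdj_erase {L : List V} {x y v : V} (h : RBAdj L x y) (hx : x ≠ v) (hy : y ≠ v) :
    RBAdj (L.erase v) x y := by
  induction L with
  | nil => simpa using h
  | cons a l ih =>
    rw [RBAdj_cons] at h
    by_cases hav : a = v
    · subst hav
      rw [List.erase_cons_head]
      rcases h with ⟨h, _⟩ | h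
      · exact absurd h.symm hx
      · exact h
    · rw [List.erase_cons_tail (by simpa using hav), RBAdj_cons]
      rcases h with ⟨h, h2⟩ | h
      · left
        refine ⟨h, ?_⟩
        rcases l with _ | ⟨b, l⟩
        · simp at h2
        · simp at h2
          subst h2
          rw [List.erase_cons_tail (by simpa using hy)]
          simp
      · exact Or.inr (ih h)

/-- insert `v` just after `u` -/
def RBins (u v : V) : List V → List V
  | [] => []
  | a :: l => if a = u then a :: v :: l else a :: RBins u v l

theorem RBins_perm {u v : V} {L : List V} (h : u ∈ L) : (RBins u v L).Perm (v :: L) := by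
  induction L with
  | nil => simp at h
  | cons a l ih =>
    unfold RBins
    split_ifs with hau
    · exact List.Perm.swap _ _ _
    · have : u ∈ l := by
        rcases List.mem_cons.1 h with h | h
        · exact absurd h.symm hau
        · exact h
      exact ((ih this).cons a).trans (List.Perm.swap _ _ _)

theorem RBins_adj {u v : V} {L : List V} (h : u ∈ L) : RBAdj (RBins u v L) u v := by
  induction L with
  | nil => simp at h
  | cons a l ih =>
    unfold RBins
    split_ifs with hau
    · rw [RBAdj_cons]; left; simp [hau]
    · have : u ∈ l := by
        rcases List.mem_cons.1 h with h | h
        · exact absurd h.symm hau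
        · exact h
      rw [RBAdj_cons]; right; exact ih this

theorem RBins_zero {u v : V} {L : List V} : (RBins u v L)[0]? = L[0]? := by
  rcases L with _ | ⟨a, l⟩
  · rfl
  · unfold RBins; split_ifs <;> simp

theorem RBins_adj' {u v x y : V} {L : List V} (hx : x ≠ u) (h : RBAdj L x y) :
    RBAdj (RBins u v L) x y := by
  induction L with
  | nil => exact h
  | cons a l ih =>
    rw [RBAdj_cons] at h
    unfold RBins
    split_ifs with hau
    · rw [RBAdj_cons, RBAdj_cons]
      rcases h with ⟨h, h2⟩ | h
      · exact absurd (h.symm.trans hau) hx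
      · exact Or.inr (Or.inr h)
    · rw [RBAdj_cons]
      rcases h with ⟨h, h2⟩ | h
      · left; rw [RBins_zero]; exact ⟨h, h2⟩
      · exact Or.inr (ih h)

theorem RBins_erase {u v : V} {L : List V} (hv : v ∉ L) : (RBins u v L).erase v = L := by
  induction L with
  | nil => rfl
  | cons a l ih =>
    simp only [List.mem_cons, not_or] at hv
    have hav : a ≠ v := fun h => hv.1 h.symm
    unfold RBins
    split_ifs with hau
    · rw [List.erase_cons_tail (by simpa using hav)]; simp
    · rw [List.erase_cons_tail (by simpa using hav), ih hv.2]

theorem RBerase_ins {u v : V} {L : List V} (hL : L.Nodup) (h : RBAdj L u v) :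
    RBins u v (L.erase v) = L := by
  have huv := RBAdj_ne hL h
  induction L with
  | nil => rfl
  | cons a l ih =>
    have hm := RBAdj_mem h
    rw [RBAdj_cons] at h
    have hav : a ≠ v := by
      rintro rfl
      rcases h with h | h
      · exact huv h.1.symm
      · exact (List.nodup_cons.1 hL).1 (RBAdj_mem h).2
    rw [List.erase_cons_tail (by simpa using hav)]
    unfold RBins
    rcases h with ⟨h, h2⟩ | h
    · rw [if_pos h]
      rcases l with _ | ⟨b, l⟩
      · simp at h2
      · simp at h2; subst h2; simp
    · have : a ≠ u := by
        rintro rfl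
        exact (List.nodup_cons.1 hL).1 (RBAdj_mem h).1
      rw [if_neg this, ih (List.nodup_cons.1 hL).2 h]

theorem RB_count (n : ℕ) : ∀ (F : Finset (V × V)) (K : List V), F.card = n → K.Nodup →
    (∀ p ∈ F, RBAdj K p.1 p.2) →
    Set.ncard {L : List V | L.Perm K ∧ ∀ p ∈ F, RBAdj L p.1 p.2} = (K.length - F.card).factorial := by
  induction n with
  | zero =>
    intro F K hF hK _
    rw [Finset.card_eq_zero] at hF
    subst hF
    have : {L : List V | L.Perm K ∧ ∀ p ∈ (∅ : Finset (V × V)), RBAdj L p.1 p.2}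
        = (K.permutations.toFinset : Set (List V)) := by
      ext L; simp
    rw [this, Set.ncard_coe_finset, List.toFinset_card_of_nodup (List.nodup_permutations _ hK),
      List.length_permutations]
    simp
  | succ n ih =>
    intro F K hF hK hFK
    have hne : F.Nonempty := by rw [← Finset.card_pos]; omega
    obtain ⟨⟨u, v⟩, huv, hmax⟩ := F.exists_max_image (fun p => K.idxOf p.2) hne
    have hA := hFK _ huv
    simp only at hA hmax
    -- facts on the other edges
    have hoth : ∀ p ∈ F.erase (u, v), p.1 ≠ u ∧ p.1 ≠ v ∧ p.2 ≠ v := by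
      rintro ⟨x, y⟩ hp
      rw [Finset.mem_erase] at hp
      have hB := hFK _ hp.2
      simp only at hB ⊢
      refine ⟨?_, ?_, ?_⟩
      · rintro rfl
        exact hp.1 (by rw [RBAdj_right hK hB hA])
      · rintro rfl
        have := hmax _ hp.2
        have h2 := ((RBAdj_iff hK).1 hB).2
        simp only at this
        omega
      · rintro rfl
        exact hp.1 (by rw [RBAdj_left hK hB hA])
    have huv' := RBAdj_ne hK hA
    have hvK := (RBAdj_mem hA).2
    have huK := (RBAdj_mem hA).1
    have hcard : (F.erase (u, v)).card = n := by rw [Finset.card_erase_of_mem huv]; omega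
    have key := ih (F.erase (u, v)) (K.erase v) hcard (hK.erase v) (fun p hp =>
      RBAdj_erase (hFK p (Finset.mem_of_mem_erase hp)) (hoth p hp).2.1 (hoth p hp).2.2)
    have hlen := List.length_erase_of_mem hvK
    have hpos := List.length_pos_of_mem hvK
    have e : (K.erase v).length - (F.erase (u, v)).card = K.length - F.card := by omega
    rw [← e, ← key]
    refine Set.ncard_congr (fun L _ => L.erase v) ?_ ?_ ?_
    · rintro L ⟨hL, hLF⟩
      exact ⟨hL.erase v, fun p hp =>
        RBAdj_erase (hLF p (Finset.mem_of_mem_erase hp)) (hoth p hp).2.1 (hoth p hp).2.2⟩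
    · rintro L M ⟨hL, hLF⟩ ⟨hM, hMF⟩ h
      rw [← RBerase_ins (hL.nodup_iff.2 hK) (hLF _ huv), ← RBerase_ins (hM.nodup_iff.2 hK) (hMF _ huv)]
      simp only [h]
    · rintro M ⟨hM, hMF⟩
      have huM : u ∈ M := hM.mem_iff.2 ((List.mem_erase_of_ne huv').2 huK)
      have hvM : v ∉ M := fun h => hK.not_mem_erase (hM.mem_iff.1 h)
      refine ⟨RBins u v M, ⟨?_, ?_⟩, RBins_erase hvM⟩
      · exact (RBins_perm huM).trans ((hM.cons v).trans (List.perm_cons_erase hvK).symm)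
      · intro p hp
        by_cases h : p = (u, v)
        · subst h; exact RBins_adj huM
        · have hp' := Finset.mem_erase.2 ⟨h, hp⟩
          exact RBins_adj' (hoth p hp').1 (hMF p hp')

variable [Fintype V]

/-- permutations containing a linear set of edges exist in listings -/
theorem RB_exists_list (σ : Equiv.Perm V) (n : ℕ) : ∀ T : Finset V, T.card = n →
    T ⊆ σ.support →
    (∀ c ∈ σ.cycleFactorsFinset, ¬ c.support ⊆ T) →
    ∃ L : List V, L.Nodup ∧ (∀ x, x ∈ L) ∧ ∀ w ∈ T, RBAdj L w (σ w) := by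
  induction n with
  | zero =>
    intro T hT _ _
    rw [Finset.card_eq_zero] at hT
    subst hT
    exact ⟨Finset.univ.toList, Finset.nodup_toList _, by simp, by simp⟩
  | succ n ih =>
    intro T hT hTs hTc
    have hne : T.Nonempty := by rw [← Finset.card_pos]; omega
    have : ∃ u ∈ T, σ u ∉ T := by
      by_contra hcon
      push Not at hcon
      obtain ⟨x, hx⟩ := hne
      refine hTc (σ.cycleOf x)
        (Equiv.Perm.cycleOf_mem_cycleFactorsFinset_iff.2 (hTs hx)) ?_
      intro y hy
      have hs := (Equiv.Perm.mem_support_cycleOf_iff.1 hy).1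
      obtain ⟨k, rfl⟩ := hs.exists_nat_pow_eq
      clear hy hs
      induction k with
      | zero => simpa using hx
      | succ k ihk => rw [pow_succ']; exact hcon _ ihk
    obtain ⟨u, hu, hv⟩ := this
    obtain ⟨L, hL, hLm, hLa⟩ := ih (T.erase u) (by rw [Finset.card_erase_of_mem hu]; omega)
      ((Finset.erase_subset _ _).trans hTs)
      (fun c hc h => hTc c hc (h.trans (Finset.erase_subset _ _)))
    have huv : u ≠ σ u := fun h => hv (h ▸ hu)
    have huM : u ∈ L.erase (σ u) := (List.mem_erase_of_ne huv).2 (hLm u)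
    have hp : (RBins u (σ u) (L.erase (σ u))).Perm L :=
      (RBins_perm huM).trans (List.perm_cons_erase (hLm _)).symm
    refine ⟨RBins u (σ u) (L.erase (σ u)), hp.nodup_iff.2 hL, fun x => hp.mem_iff.2 (hLm x), ?_⟩
    intro w hw
    by_cases hwu : w = u
    · subst hwu; exact RBins_adj huM
    · refine RBins_adj' hwu (RBAdj_erase (hLa w (Finset.mem_erase.2 ⟨hwu, hw⟩)) ?_ ?_)
      · rintro rfl; exact hv hw
      · exact fun h => hwu (σ.injective h)

theorem RB_perm_count (σ₀ : Equiv.Perm V) (T : Finset V) :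
    Nat.card {σ : Equiv.Perm V // ∀ w ∈ T, σ w = σ₀ w} = (Fintype.card V - T.card).factorial := by
  have e1 : {σ : Equiv.Perm V // ∀ w ∈ T, σ w = σ₀ w} ≃
      {σ : Equiv.Perm V // ∀ w, ¬ (w ∉ T) → σ w = w} :=
    (Equiv.mulLeft σ₀⁻¹).subtypeEquiv (by
      intro σ
      simp only [not_not, Equiv.coe_mulLeft, Equiv.Perm.mul_apply, Equiv.Perm.inv_eq_iff_eq])
  rw [Nat.card_congr (e1.trans (Equiv.Perm.subtypeEquivSubtypePerm (fun w => w ∉ T)).symm),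
    Nat.card_eq_fintype_card, Fintype.card_perm]
  congr 1
  simp [Fintype.card_subtype_compl]

/-- `F` is contained in the graph of `σ`, with no complete cycle. -/
def RBGood (σ : Equiv.Perm V) (F : Finset (V × V)) : Prop :=
  (∀ p ∈ F, σ p.1 = p.2 ∧ p.1 ≠ p.2) ∧
    ∀ c ∈ σ.cycleFactorsFinset, ¬ c.support ⊆ F.image Prod.fst

theorem RB_card (F : Finset (V × V)) :
    Nat.card {L : List V // (L.Nodup ∧ ∀ x, x ∈ L) ∧ ∀ p ∈ F, RBAdj L p.1 p.2} =
    Nat.card {σ : Equiv.Perm V // RBGood σ F} := by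
  by_cases hex : ∃ L : List V, (L.Nodup ∧ ∀ x, x ∈ L) ∧ ∀ p ∈ F, RBAdj L p.1 p.2
  · obtain ⟨K, ⟨hK, hKm⟩, hKF⟩ := hex
    have hlen : K.length = Fintype.card V := by
      rw [← List.toFinset_card_of_nodup hK, ← Finset.card_univ]
      congr 1; ext; simp [hKm]
    have hinj : Set.InjOn Prod.fst (F : Set (V × V)) := by
      rintro ⟨x, y⟩ h1 ⟨x', y'⟩ h2 h
      simp only at h
      subst h
      have : y = y' := RBAdj_right hK (hKF (x, y) h1) (hKF (x, y') h2)
      rw [this]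
    have hT : (F.image Prod.fst).card = F.card := Finset.card_image_of_injOn hinj
    have hlist : Nat.card {L : List V // (L.Nodup ∧ ∀ x, x ∈ L) ∧ ∀ p ∈ F, RBAdj L p.1 p.2} =
        (Fintype.card V - F.card).factorial := by
      rw [← hlen, ← RB_count _ F K rfl hK hKF]
      refine Nat.card_congr (Equiv.subtypeEquivRight ?_)
      intro L
      refine and_congr_left fun _ => ?_
      constructor
      · rintro ⟨h1, h2⟩
        exact (List.perm_ext_iff_of_nodup h1 hK).2 (by simp [h2, hKm])
      · intro h
        exact ⟨h.nodup_iff.2 hK, fun x => h.mem_iff.2 (hKm x)⟩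
    rw [hlist, ← hT, ← RB_perm_count K.formPerm]
    refine Nat.card_congr (Equiv.subtypeEquivRight ?_)
    intro σ
    have hform : ∀ p ∈ F, K.formPerm p.1 = p.2 := by
      intro p hp
      obtain ⟨i, h1, h2⟩ := hKF p hp
      obtain ⟨hi, h1⟩ := List.getElem?_eq_some_iff.1 h1
      obtain ⟨hi', h2⟩ := List.getElem?_eq_some_iff.1 h2
      rw [← h1, ← h2]
      exact List.formPerm_apply_lt_getElem K hK i hi'
    constructor
    · intro h
      have hσ : ∀ p ∈ F, σ p.1 = p.2 := fun p hp =>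
        (h _ (Finset.mem_image_of_mem _ hp)).trans (hform p hp)
      refine ⟨fun p hp => ⟨hσ p hp, RBAdj_ne hK (hKF p hp)⟩, ?_⟩
      intro c hc hsub
      have hcyc := (Equiv.Perm.mem_cycleFactorsFinset_iff.1 hc).1
      obtain ⟨w, hw, hmax⟩ := c.support.exists_max_image (fun x => K.idxOf x)
        hcyc.nonempty_support
      obtain ⟨p, hp, rfl⟩ := Finset.mem_image.1 (hsub hw)
      have h1 := (Equiv.Perm.mem_cycleFactorsFinset_iff.1 hc).2 _ hw
      have h2 := hmax _ (Equiv.Perm.apply_mem_support.2 hw)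
      rw [h1, hσ p hp] at h2
      have := ((RBAdj_iff hK).1 (hKF p hp)).2
      omega
    · rintro ⟨h, _⟩ w hw
      obtain ⟨p, hp, rfl⟩ := Finset.mem_image.1 hw
      rw [hform p hp, (h p hp).1]
  · have h1 : IsEmpty {L : List V // (L.Nodup ∧ ∀ x, x ∈ L) ∧ ∀ p ∈ F, RBAdj L p.1 p.2} :=
      ⟨fun L => hex ⟨L.1, L.2⟩⟩
    have h2 : IsEmpty {σ : Equiv.Perm V // RBGood σ F} := by
      refine ⟨fun ⟨σ, h, hc⟩ => hex ?_⟩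
      obtain ⟨L, hL, hLm, hLa⟩ := RB_exists_list σ _ (F.image Prod.fst) rfl (by
        intro w hw
        obtain ⟨p, hp, rfl⟩ := Finset.mem_image.1 hw
        rw [Equiv.Perm.mem_support, (h p hp).1]
        exact (h p hp).2.symm) hc
      refine ⟨L, ⟨hL, hLm⟩, fun p hp => ?_⟩
      rw [← (h p hp).1]
      exact hLa _ (Finset.mem_image_of_mem _ hp)
    rw [Nat.card_of_isEmpty, Nat.card_of_isEmpty]

end RB

section RB2
variable {V : Type*} [DecidableEq V]

theorem RB_prod {ι : Type*} [DecidableEq ι] (C : Finset ι) (s : ι → Finset V) (A : Finset V)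
    (hd : ∀ a ∈ C, ∀ b ∈ C, a ≠ b → Disjoint (s a) (s b)) :
    ∑ T ∈ ((C.biUnion s) ∩ A).powerset with ∀ c ∈ C, ¬ s c ⊆ T, (-1 : ℤ) ^ T.card =
      ∏ c ∈ C, ∑ T ∈ (s c ∩ A).powerset with ¬ s c ⊆ T, (-1 : ℤ) ^ T.card := by
  induction C using Finset.induction_on with
  | empty => simp
  | insert a C ha ih =>
    rw [Finset.prod_insert ha, ← ih (fun x hx y hy => hd x (Finset.mem_insert_of_mem hx) y
      (Finset.mem_insert_of_mem hy)), Finset.sum_mul_sum, ← Finset.sum_product']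
    have hdis : ∀ c ∈ C, Disjoint (s a) (s c) := fun c hc => hd a (Finset.mem_insert_self _ _) c
      (Finset.mem_insert_of_mem hc) (by rintro rfl; exact ha hc)
    have hdU : Disjoint (s a) (C.biUnion s) := (Finset.disjoint_biUnion_right _ _ _).2 hdis
    rw [Finset.disjoint_left] at hdU
    refine Finset.sum_nbij' (fun T => (T ∩ s a, T ∩ C.biUnion s)) (fun P => P.1 ∪ P.2) ?_ ?_ ?_ ?_ ?_
    · intro T hT
      simp only [Finset.mem_filter, Finset.mem_powerset, Finset.mem_product, Finset.biUnion_insert]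
        at hT ⊢
      obtain ⟨hT, hc⟩ := hT
      refine ⟨⟨?_, ?_⟩, ?_, ?_⟩
      · intro x hx
        have := hT (Finset.mem_inter.1 hx).1
        grind
      · intro h
        exact hc a (Finset.mem_insert_self _ _) (h.trans Finset.inter_subset_left)
      · intro x hx
        have := hT (Finset.mem_inter.1 hx).1
        grind
      · intro c hcC h
        exact hc c (Finset.mem_insert_of_mem hcC) (h.trans Finset.inter_subset_left)
    · rintro ⟨P, Q⟩ hPQ
      simp only [Finset.mem_filter, Finset.mem_powerset, Finset.mem_product, Finset.biUnion_insert]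
        at hPQ ⊢
      obtain ⟨⟨h1, h2⟩, h3, h4⟩ := hPQ
      refine ⟨?_, ?_⟩
      · intro x hx
        rcases Finset.mem_union.1 hx with hx | hx
        · have := h1 hx; grind
        · have := h3 hx; grind
      · intro c hcC h
        rcases Finset.mem_insert.1 hcC with rfl | hcC
        · apply h2
          intro x hx
          rcases Finset.mem_union.1 (h hx) with h' | h'
          · exact h'
          · exact absurd (Finset.mem_inter.1 (h3 h')).1 (hdU hx)
        · apply h4 c hcC
          intro x hx
          rcases Finset.mem_union.1 (h hx) with h' | h'
          · exact absurd (Finset.mem_biUnion.2 ⟨c, hcC, hx⟩) (hdU (Finset.mem_inter.1 (h1 h')).1)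
          · exact h'
    · intro T hT
      simp only [Finset.mem_filter, Finset.mem_powerset, Finset.biUnion_insert] at hT
      ext x
      have := @hT.1 x
      grind
    · rintro ⟨P, Q⟩ hPQ
      simp only [Finset.mem_filter, Finset.mem_powerset, Finset.mem_product] at hPQ
      obtain ⟨⟨h1, h2⟩, h3, h4⟩ := hPQ
      ext x
      · have := @h1 x; have := @h3 x; have := @hdU x
        simp only [Finset.mem_inter, Finset.mem_union] at *
        tauto
      · have := @h1 x; have := @h3 x; have := @hdU x
        simp only [Finset.mem_inter, Finset.mem_union] at *
        tauto
    · intro T hT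
      simp only [Finset.mem_filter, Finset.mem_powerset, Finset.biUnion_insert] at hT
      rw [← pow_add, ← Finset.card_union_of_disjoint]
      · congr 2
        ext x
        have := @hT.1 x
        grind
      · rw [Finset.disjoint_left]
        intro x hx hx'
        exact hdU (Finset.mem_inter.1 hx).2 (Finset.mem_inter.1 hx').2

theorem RB_single (S A : Finset V) (hS : S.Nonempty) :
    ∑ T ∈ (S ∩ A).powerset with ¬ S ⊆ T, (-1 : ℤ) ^ T.card =
      if S ⊆ A then (-1) ^ (S.card - 1) else if Disjoint S A then 1 else 0 := by
  have hpos := hS.card_pos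
  split_ifs with h1 h2
  · have e : (S ∩ A).powerset.filter (fun T => ¬ S ⊆ T) = S.powerset.erase S := by
      rw [Finset.inter_eq_left.2 h1]
      ext T
      simp only [Finset.mem_filter, Finset.mem_powerset, Finset.mem_erase]
      constructor
      · rintro ⟨h, h'⟩
        exact ⟨by rintro rfl; exact h' subset_rfl, h⟩
      · rintro ⟨h, h'⟩
        exact ⟨h', fun h'' => h (h'.antisymm h'')⟩
    rw [e]
    have h3 := Finset.sum_erase_add S.powerset (fun T => (-1 : ℤ) ^ T.card)
      (Finset.mem_powerset_self S)
    rw [Finset.sum_powerset_neg_one_pow_card, if_neg hS.ne_empty] at h3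
    obtain ⟨k, hk⟩ : ∃ k, S.card = k + 1 := ⟨S.card - 1, by omega⟩
    rw [hk, pow_succ] at h3
    rw [hk, Nat.add_sub_cancel]
    linarith
  · rw [Finset.disjoint_iff_inter_eq_empty.1 h2]
    simp [Finset.filter_singleton, hS.ne_empty]
  · have e : (S ∩ A).powerset.filter (fun T => ¬ S ⊆ T) = (S ∩ A).powerset := by
      rw [Finset.filter_eq_self]
      intro T hT h
      exact h1 (h.trans ((Finset.mem_powerset.1 hT).trans Finset.inter_subset_right))
    rw [e, Finset.sum_powerset_neg_one_pow_card, if_neg]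
    rwa [← Finset.disjoint_iff_inter_eq_empty]

variable [Fintype V]

open Classical in
theorem RB_cycles (E : Set (V × V)) (σ : Equiv.Perm V) :
    ∑ T ∈ (σ.support.filter (fun w => (w, σ w) ∈ E)).powerset with
        ∀ c ∈ σ.cycleFactorsFinset, ¬ c.support ⊆ T, (-1 : ℤ) ^ T.card =
      if MemSVXXbar E σ then (-1 : ℤ) ^ phi E σ else 0 := by
  have hsupp : σ.cycleFactorsFinset.biUnion (fun c => c.support) = σ.support := by
    ext x
    rw [Finset.mem_biUnion]
    constructor
    · rintro ⟨c, hc, hx⟩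
      exact Equiv.Perm.mem_cycleFactorsFinset_support_le hc hx
    · intro hx
      exact ⟨σ.cycleOf x, Equiv.Perm.cycleOf_mem_cycleFactorsFinset_iff.2 hx,
        Equiv.Perm.mem_support_cycleOf_iff.2 ⟨Equiv.Perm.SameCycle.refl _ _, hx⟩⟩
  have h1 := RB_prod σ.cycleFactorsFinset (fun c => c.support)
    (Finset.univ.filter (fun w => (w, σ w) ∈ E)) (by
      intro a ha b hb hab
      exact (Equiv.Perm.cycleFactorsFinset_pairwise_disjoint σ ha hb hab).disjoint_support)
  rw [hsupp] at h1
  have h2 : σ.support ∩ Finset.univ.filter (fun w => (w, σ w) ∈ E) =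
      σ.support.filter (fun w => (w, σ w) ∈ E) := by ext; simp
  rw [h2] at h1
  refine (Finset.sum_congr (by ext T; simp only [Finset.mem_filter]) fun _ _ => rfl).trans
    (h1.trans ?_)
  have hE : ∀ c ∈ σ.cycleFactorsFinset,
      (c.support ⊆ Finset.univ.filter (fun w => (w, σ w) ∈ E) ↔ IsDigraphCycle E c) := by
    intro c hc
    have := (Equiv.Perm.mem_cycleFactorsFinset_iff.1 hc).2
    constructor
    · intro h w hw
      rw [this w hw]; simpa using h hw
    · intro h w hw
      have := h w hw
      rw [(Equiv.Perm.mem_cycleFactorsFinset_iff.1 hc).2 w hw] at this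
      simpa using this
  have hEc : ∀ c ∈ σ.cycleFactorsFinset,
      (Disjoint c.support (Finset.univ.filter (fun w => (w, σ w) ∈ E)) ↔ IsDigraphCycle Eᶜ c) := by
    intro c hc
    rw [Finset.disjoint_left]
    refine forall₂_congr fun w hw => ?_
    rw [(Equiv.Perm.mem_cycleFactorsFinset_iff.1 hc).2 w hw]
    simp
  have h3 : ∀ c ∈ σ.cycleFactorsFinset,
      ∑ T ∈ (c.support ∩ Finset.univ.filter (fun w => (w, σ w) ∈ E)).powerset with
        ¬ c.support ⊆ T, (-1 : ℤ) ^ T.card =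
      if IsDigraphCycle E c then (-1) ^ (c.support.card - 1)
        else if IsDigraphCycle Eᶜ c then 1 else 0 := by
    intro c hc
    rw [RB_single _ _ (Equiv.Perm.mem_cycleFactorsFinset_iff.1 hc).1.nonempty_support]
    simp only [hE c hc, hEc c hc]
  refine (Finset.prod_congr rfl fun c hc => (Finset.sum_congr
    (by ext T; simp only [Finset.mem_filter]) fun _ _ => rfl).trans (h3 c hc)).trans ?_
  split_ifs with hM
  · unfold phi
    rw [← Finset.prod_pow_eq_pow_sum, Finset.prod_filter]
    refine Finset.prod_congr rfl fun c hc => ?_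
    rcases hM c hc with h | h
    · simp [h]
    · simp [h]
  · unfold MemSVXXbar at hM
    push Not at hM
    obtain ⟨c, hc, h, h'⟩ := hM
    exact Finset.prod_eq_zero hc (by simp [h, h'])

open Classical in
theorem RB_cycles' (E : Set (V × V)) (σ : Equiv.Perm V) :
    ∑ F : Finset (V × V), (if (∀ p ∈ F, p ∈ E) ∧ RBGood σ F then (-1 : ℤ) ^ F.card else 0) =
      if MemSVXXbar E σ then (-1 : ℤ) ^ phi E σ else 0 := by
  rw [← RB_cycles, ← Finset.sum_filter]
  have key : ∀ T : Finset V, (T.image (fun w => (w, σ w))).image Prod.fst = T := by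
    intro T; simp [Finset.image_image, Function.comp_def]
  have key2 : ∀ F : Finset (V × V), RBGood σ F →
      (F.image Prod.fst).image (fun w => (w, σ w)) = F := by
    intro F hF
    rw [Finset.image_image]
    conv_rhs => rw [← Finset.image_id (s := F)]
    refine Finset.image_congr fun p hp => ?_
    have := (hF.1 p hp).1
    ext <;> simp [this]
  refine Finset.sum_nbij' (fun F => F.image Prod.fst) (fun T => T.image (fun w => (w, σ w)))
    ?_ ?_ ?_ ?_ ?_
  · intro F hF
    simp only [Finset.mem_filter, Finset.mem_univ, true_and, Finset.mem_powerset] at hF ⊢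
    refine ⟨?_, hF.2.2⟩
    intro w hw
    obtain ⟨p, hp, rfl⟩ := Finset.mem_image.1 hw
    have := hF.2.1 p hp
    rw [Finset.mem_filter, Equiv.Perm.mem_support, this.1]
    exact ⟨this.2.symm, hF.1 p hp⟩
  · intro T hT
    simp only [Finset.mem_filter, Finset.mem_univ, true_and, Finset.mem_powerset] at hT ⊢
    refine ⟨?_, ?_, ?_⟩
    · intro p hp
      obtain ⟨w, hw, rfl⟩ := Finset.mem_image.1 hp
      exact (Finset.mem_filter.1 (hT.1 hw)).2
    · intro p hp
      obtain ⟨w, hw, rfl⟩ := Finset.mem_image.1 hp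
      exact ⟨rfl, (Equiv.Perm.mem_support.1 (Finset.mem_filter.1 (hT.1 hw)).1).symm⟩
    · rw [key]; exact hT.2
  · intro F hF
    exact key2 F (Finset.mem_filter.1 hF).2.2
  · intro T _
    exact key T
  · intro F hF
    conv_lhs => rw [← key2 F (Finset.mem_filter.1 hF).2.2]
    rw [Finset.card_image_of_injective]
    intro a b h
    exact (Prod.ext_iff.1 h).1

/-- The type of listings, as lists -/
abbrev RBList (V : Type*) := {L : List V // L.Nodup ∧ ∀ x, x ∈ L}

theorem RBAdj_ofFn {n : ℕ} (σ : Fin n → V) (x y : V) :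
    RBAdj (List.ofFn σ) x y ↔ ∃ i : Fin n, ∃ h : (i : ℕ) + 1 < n, σ i = x ∧ σ ⟨i + 1, h⟩ = y := by
  constructor
  · rintro ⟨i, h1, h2⟩
    obtain ⟨hi, h1⟩ := List.getElem?_eq_some_iff.1 h1
    obtain ⟨hi', h2⟩ := List.getElem?_eq_some_iff.1 h2
    rw [List.length_ofFn] at hi hi'
    exact ⟨⟨i, hi⟩, hi', by simpa using h1, by simpa using h2⟩
  · rintro ⟨i, h, rfl, rfl⟩
    refine ⟨i, ?_, ?_⟩
    · rw [List.getElem?_eq_getElem (by simp)]; simp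
    · rw [List.getElem?_eq_getElem (by simpa using h)]; simp

noncomputable def RBequiv : (Fin (Fintype.card V) ≃ V) ≃ RBList V :=
  Equiv.ofBijective (fun σ => ⟨List.ofFn σ, List.nodup_ofFn.2 σ.injective, fun x => by
    rw [List.mem_ofFn]; exact σ.surjective x⟩) (by
    constructor
    · intro σ τ h
      have := List.ofFn_injective (congrArg Subtype.val h)
      exact Equiv.coe_fn_injective this
    · rintro ⟨L, hL, hm⟩
      have hlen : L.length = Fintype.card V := by
        rw [← List.toFinset_card_of_nodup hL, ← Finset.card_univ]
        congr 1; ext; simp [hm]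
      refine ⟨(finCongr hlen.symm).trans (hL.getEquivOfForallMemList L hm), ?_⟩
      apply Subtype.ext
      apply List.ext_getElem
      · simp [hlen]
      · intro i h1 h2
        simp)

theorem RBequiv_coe (σ : Fin (Fintype.card V) ≃ V) : (RBequiv σ).1 = List.ofFn σ := rfl

instance : Finite (RBList V) := Finite.of_equiv _ (RBequiv (V := V))

open Classical in
theorem RB_main (E : Set (V × V)) :
    (Nat.card {L : RBList V // ∀ p : V × V, RBAdj L.1 p.1 p.2 → p ∉ E} : ℤ) =
      ∑ σ : Equiv.Perm V, if MemSVXXbar E σ then (-1 : ℤ) ^ phi E σ else 0 := by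
  have : Fintype (RBList V) := Fintype.ofFinite _
  simp only [← RB_cycles']
  rw [Finset.sum_comm, Nat.card_eq_fintype_card, Fintype.card_subtype, Finset.card_filter]
  push_cast
  have h1 : ∀ L : RBList V, (if ∀ p : V × V, RBAdj L.1 p.1 p.2 → p ∉ E then (1 : ℤ) else 0) =
      ∑ F : Finset (V × V), if (∀ p ∈ F, p ∈ E) ∧ (∀ p ∈ F, RBAdj L.1 p.1 p.2)
        then (-1 : ℤ) ^ F.card else 0 := by
    intro L
    have := Finset.sum_powerset_neg_one_pow_card
      (x := Finset.univ.filter (fun p : V × V => p ∈ E ∧ RBAdj L.1 p.1 p.2))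
    rw [← Finset.sum_filter]
    have e : Finset.univ.filter (fun F : Finset (V × V) =>
        (∀ p ∈ F, p ∈ E) ∧ (∀ p ∈ F, RBAdj L.1 p.1 p.2)) =
        (Finset.univ.filter (fun p : V × V => p ∈ E ∧ RBAdj L.1 p.1 p.2)).powerset := by
      ext F
      simp only [Finset.mem_filter, Finset.mem_univ, true_and, Finset.mem_powerset,
        Finset.subset_iff]
      exact ⟨fun h p hp => ⟨h.1 p hp, h.2 p hp⟩, fun h => ⟨fun p hp => (h hp).1, fun p hp => (h hp).2⟩⟩
    rw [e, this]
    refine if_congr ?_ rfl rfl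
    rw [Finset.filter_eq_empty_iff]
    constructor
    · intro h p _ hp; exact h p hp.2 hp.1
    · intro h p hp hE; exact h (Finset.mem_univ p) ⟨hE, hp⟩
  rw [Finset.sum_congr rfl fun L _ => h1 L, Finset.sum_comm]
  refine Finset.sum_congr rfl fun F _ => ?_
  by_cases hF : ∀ p ∈ F, p ∈ E
  · have hc := RB_card F
    have hc2 : Nat.card {L : List V // (L.Nodup ∧ ∀ x, x ∈ L) ∧ ∀ p ∈ F, RBAdj L p.1 p.2} =
        Nat.card {L : RBList V // ∀ p ∈ F, RBAdj L.1 p.1 p.2} :=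
      Nat.card_congr (Equiv.subtypeSubtypeEquivSubtypeInter _ _).symm
    rw [hc2, Nat.card_eq_fintype_card, Nat.card_eq_fintype_card, Fintype.card_subtype,
      Fintype.card_subtype] at hc
    have hF' : (∀ p ∈ F, p ∈ E) ↔ True := iff_true_intro hF
    simp only [hF', true_and]
    rw [← Finset.sum_filter, ← Finset.sum_filter, Finset.sum_const, Finset.sum_const, hc]
  · simp only [hF, false_and, if_false, Finset.sum_const_zero]

/-- The bad pairs -/
def RBbad (E : Set (V × V)) (f : V → ℕ+) : Set (V × V) :=
  {p | f p.2 < f p.1 ∨ (f p.1 = f p.2 ∧ p ∈ E)}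

theorem RB_friendly (E : Set (V × V)) (f : V → ℕ+) (σ : Fin (Fintype.card V) ≃ V) :
    Friendly E f σ ↔ ∀ p : V × V, RBAdj (RBequiv σ).1 p.1 p.2 → p ∉ RBbad E f := by
  rw [RBequiv_coe]
  constructor
  · rintro ⟨h1, h2⟩ ⟨x, y⟩ hp hb
    obtain ⟨i, h, hx, hy⟩ := (RBAdj_ofFn _ _ _).1 hp
    simp only at hx hy
    subst hx hy
    rcases hb with hb | ⟨hb, hE⟩
    · exact absurd (h1 (show i ≤ ⟨i + 1, h⟩ from Fin.le_def.2 (Nat.le_succ _))) (not_le.2 hb)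
    · exact absurd hb (h2 i h hE).ne
  · intro H
    have H' : ∀ (i : Fin (Fintype.card V)) (h : (i : ℕ) + 1 < Fintype.card V),
        (σ i, σ ⟨i + 1, h⟩) ∉ RBbad E f := fun i h => H _ ((RBAdj_ofFn _ _ _).2 ⟨i, h, rfl, rfl⟩)
    have hle : ∀ (i : Fin (Fintype.card V)) (h : (i : ℕ) + 1 < Fintype.card V),
        f (σ i) ≤ f (σ ⟨i + 1, h⟩) := fun i h => not_lt.1 fun hlt => H' i h (Or.inl hlt)
    refine ⟨?_, ?_⟩
    · have : ∀ (k : ℕ) (hk : k < Fintype.card V) (i : ℕ) (hi : i ≤ k),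
          f (σ ⟨i, by omega⟩) ≤ f (σ ⟨k, hk⟩) := by
        intro k
        induction k with
        | zero => intro hk i hi; obtain rfl : i = 0 := by omega
                  exact le_rfl
        | succ k ih =>
          intro hk i hi
          rcases Nat.lt_or_ge k i with h | h
          · obtain rfl : i = k + 1 := by omega
            exact le_rfl
          · exact (ih (by omega) i h).trans (hle ⟨k, by omega⟩ hk)
      intro i j hij
      exact this j j.2 i hij
    · intro i h hE
      exact lt_of_le_of_ne (hle i h) fun heq => H' i h (Or.inr ⟨heq, hE⟩)

theorem RB_const_le (f : V → ℕ+) (c : Equiv.Perm V) (h : ∀ w ∈ c.support, f (c w) ≤ f w) :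
    ∀ w ∈ c.support, f (c w) = f w := by
  have h1 := Equiv.Perm.sum_comp c c.support (fun w => (f w : ℕ)) (by intro x hx; simpa using hx)
  have h2 := (Finset.sum_eq_sum_iff_of_le (s := c.support) (f := fun w => (f (c w) : ℕ))
    (g := fun w => (f w : ℕ)) (fun w hw => by exact_mod_cast h w hw)).1 h1
  intro w hw
  exact_mod_cast h2 w hw

theorem RB_const_ge (f : V → ℕ+) (c : Equiv.Perm V) (h : ∀ w ∈ c.support, f w ≤ f (c w)) :
    ∀ w ∈ c.support, f (c w) = f w := by
  have h1 := Equiv.Perm.sum_comp c c.support (fun w => (f w : ℕ)) (by intro x hx; simpa using hx)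
  have h2 := (Finset.sum_eq_sum_iff_of_le (s := c.support) (g := fun w => (f (c w) : ℕ))
    (f := fun w => (f w : ℕ)) (fun w hw => by exact_mod_cast h w hw)).1 h1.symm
  intro w hw
  exact_mod_cast (h2 w hw).symm

theorem RB_cyc1 (E : Set (V × V)) (f : V → ℕ+) (c : Equiv.Perm V) :
    IsDigraphCycle (RBbad E f) c ↔ IsDigraphCycle E c ∧ ∀ w ∈ c.support, f (c w) = f w := by
  constructor
  · intro h
    have hc : ∀ w ∈ c.support, f (c w) = f w := RB_const_le f c fun w hw => by
      rcases h w hw with h | h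
      · exact h.le
      · exact h.1.ge
    refine ⟨fun w hw => ?_, hc⟩
    rcases h w hw with h | h
    · exact absurd (hc w hw) h.ne
    · exact h.2
  · rintro ⟨h, hc⟩ w hw
    exact Or.inr ⟨(hc w hw).symm, h w hw⟩

theorem RB_cyc2 (E : Set (V × V)) (f : V → ℕ+) (c : Equiv.Perm V) :
    IsDigraphCycle (RBbad E f)ᶜ c ↔ IsDigraphCycle Eᶜ c ∧ ∀ w ∈ c.support, f (c w) = f w := by
  constructor
  · intro h
    have hc : ∀ w ∈ c.support, f (c w) = f w := RB_const_ge f c fun w hw =>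
      not_lt.1 fun hlt => h w hw (Or.inl hlt)
    refine ⟨fun w hw hE => h w hw (Or.inr ⟨(hc w hw).symm, hE⟩), hc⟩
  · rintro ⟨h, hc⟩ w hw hb
    rcases hb with hb | hb
    · exact absurd (hc w hw) (ne_of_lt hb)
    · exact h w hw hb.2

theorem RB_const (f : V → ℕ+) (σ : Equiv.Perm V) :
    (∀ w, f (σ w) = f w) ↔ ∀ c ∈ σ.cycleFactorsFinset, ∀ w ∈ c.support, f (c w) = f w := by
  constructor
  · intro h c hc w hw
    rw [(Equiv.Perm.mem_cycleFactorsFinset_iff.1 hc).2 w hw, h]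
  · intro h w
    by_cases hw : w ∈ σ.support
    · have := h _ (Equiv.Perm.cycleOf_mem_cycleFactorsFinset_iff.2 hw) w
        (Equiv.Perm.mem_support_cycleOf_iff.2 ⟨Equiv.Perm.SameCycle.refl _ _, hw⟩)
      rwa [Equiv.Perm.cycleOf_apply_self] at this
    · rw [Equiv.Perm.notMem_support.1 hw]

theorem RB_mem (E : Set (V × V)) (f : V → ℕ+) (σ : Equiv.Perm V) :
    MemSVXXbar (RBbad E f) σ ↔ MemSVXXbar E σ ∧ ∀ w, f (σ w) = f w := by
  rw [RB_const]
  unfold MemSVXXbar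
  simp only [RB_cyc1, RB_cyc2, ← or_and_right]
  exact ⟨fun h => ⟨fun c hc => (h c hc).1, fun c hc => (h c hc).2⟩,
    fun h c hc => ⟨h.1 c hc, h.2 c hc⟩⟩

open Classical in
theorem RB_phi (E : Set (V × V)) (f : V → ℕ+) (σ : Equiv.Perm V) (h : ∀ w, f (σ w) = f w) :
    phi (RBbad E f) σ = phi E σ := by
  unfold phi
  refine Finset.sum_congr (Finset.filter_congr fun c hc => ?_) fun _ _ => rfl
  rw [RB_cyc1]
  exact and_iff_left ((RB_const f σ).1 h c hc)

end RB2

open Classical in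
/-- Power sum expansion of the noncommutative Redei–Berge function: for any digraph
`X = (V, E)` and coloring `f`, `N(f, X) = Σ (−1)^{φ(σ)}`, summed over all permutations
`σ ∈ 𝕊_V(X, X̄)` such that `f` is constant on each cycle of `σ`. -/
theorem redeiBergeCount_powerSum_expansion {V : Type*} [Fintype V] [DecidableEq V]
    (E : Set (V × V)) (f : V → ℕ+) :
    (redeiBergeCount E f : ℤ) =
      ∑ σ : Equiv.Perm V,
        if MemSVXXbar E σ ∧ ∀ w : V, f (σ w) = f w then (-1 : ℤ) ^ phi E σ else 0 := by
  simp only [← RB_mem]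
  have h : redeiBergeCount E f =
      Nat.card {L : RBList V // ∀ p : V × V, RBAdj L.1 p.1 p.2 → p ∉ RBbad E f} :=
    Nat.card_congr (RBequiv.subtypeEquiv (RB_friendly E f))
  rw [h, RB_main]
  refine Finset.sum_congr rfl fun σ _ => ?_
  split_ifs with hM
  · rw [RB_phi E f σ ((RB_mem E f σ).1 hM).2]
  · rfl
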